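/- Suppose n = 2 and d ≥ 3. Then there exists an integer q ≥ 2 such that the Veronese–Koszul complex at (3d−2, q) is not exact. (Equivalently, the d-uple Veronese embedding of P^2 does not satisfy property N_{3d−2}.) -/

import Mathlib

open TensorProduct

noncomputable section

variable (K : Type*) [Field K]

/-- `S K n e` is the space of homogeneous polynomials of degree `e`
in the `n+1` variables `x_0, …, x_n`. -/
abbrev S (n e : ℕ) : Submodule K (MvPolynomial (Fin (n + 1)) K) :=
  MvPolynomial.homogeneousSubmodule (Fin (n + 1)) K e

/-- The product of a homogeneous polynomial of degree `d` with one of degree `b`,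
viewed as an element of degree `b + d`. -/
def mulSW {n d b : ℕ} (s : S K n d) (w : S K n b) : S K n (b + d) :=
  ⟨(s : MvPolynomial (Fin (n + 1)) K) * (w : MvPolynomial (Fin (n + 1)) K), by
    rw [MvPolynomial.mem_homogeneousSubmodule, Nat.add_comm b d]
    exact ((MvPolynomial.mem_homogeneousSubmodule _ _).1 s.2).mul
      ((MvPolynomial.mem_homogeneousSubmodule _ _).1 w.2)⟩

/-- Identification of spaces of homogeneous polynomials of equal degrees. -/
def scast {n e₁ e₂ : ℕ} (h : e₁ = e₂) : S K n e₁ ≃ₗ[K] S K n e₂ :=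
  LinearEquiv.ofEq _ _ (by rw [h])

/-- The increasing injection `Fin (a-1) → Fin a` omitting `j`. -/
def skipAt {a : ℕ} (j : Fin a) (i : Fin (a - 1)) : Fin a :=
  if (i : ℕ) < (j : ℕ) then ⟨i, by have := i.isLt; omega⟩
  else ⟨(i : ℕ) + 1, by have := i.isLt; omega⟩

/-- The wedge `v 0 ∧ ⋯ ∧ v (a-1)` as an element of the `a`-th exterior power. -/
def wedge {M : Type*} [AddCommGroup M] [Module K M] (a : ℕ) (v : Fin a → M) :
    ⋀[K]^a M :=
  ⟨ExteriorAlgebra.ιMulti K a v, ExteriorAlgebra.ιMulti_range K a ⟨v, rfl⟩⟩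

/-- `IsKoszulMap K n d a b δ` says that `δ : ⋀^a S_d ⊗ S_b → ⋀^{a-1} S_d ⊗ S_{b+d}` is
the Koszul map, i.e. it satisfies
`δ((s_1 ∧ ⋯ ∧ s_a) ⊗ w) = Σ_j (−1)^{j−1} (s_1 ∧ ⋯ ∧ ŝ_j ∧ ⋯ ∧ s_a) ⊗ (s_j·w)`. -/
def IsKoszulMap (n d a b : ℕ)
    (δ : ((⋀[K]^a (S K n d)) ⊗[K] (S K n b)) →ₗ[K]
         ((⋀[K]^(a - 1) (S K n d)) ⊗[K] (S K n (b + d)))) : Prop :=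
  ∀ (s : Fin a → S K n d) (w : S K n b),
    δ (wedge K a s ⊗ₜ[K] w) =
      ∑ j : Fin a, ((-1 : K) ^ (j : ℕ)) •
        ((wedge K (a - 1) fun i => s (skipAt j i)) ⊗ₜ[K] mulSW K (s j) w)

/-- Exactness of the Veronese–Koszul complex at `(i, q)`:
`ker δ_{i,qd} = im δ_{i+1,(q−1)d}` inside `⋀^i S_d ⊗ S_{qd}`. -/
def VKExact (n d i q : ℕ) : Prop :=
  ∀ (h : (q - 1) * d + d = q * d)
    (δ₁ : ((⋀[K]^i (S K n d)) ⊗[K] (S K n (q * d))) →ₗ[K]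
          ((⋀[K]^(i - 1) (S K n d)) ⊗[K] (S K n (q * d + d))))
    (δ₂ : ((⋀[K]^(i + 1) (S K n d)) ⊗[K] (S K n ((q - 1) * d))) →ₗ[K]
          ((⋀[K]^i (S K n d)) ⊗[K] (S K n ((q - 1) * d + d)))),
    IsKoszulMap K n d i (q * d) δ₁ → IsKoszulMap K n d (i + 1) ((q - 1) * d) δ₂ →
    LinearMap.ker δ₁ =
      LinearMap.range
        ((TensorProduct.congr (LinearEquiv.refl K (⋀[K]^i (S K n d)))
            (scast K h)).toLinearMap ∘ₗ δ₂)

end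


open TensorProduct

namespace VK

noncomputable section

section generic

variable {R V W W' W'' : Type*} [CommRing R] [AddCommGroup V] [Module R V]
  [AddCommGroup W] [Module R W] [AddCommGroup W'] [Module R W'] [AddCommGroup W''] [Module R W'']

/-- `w ↦ (v ↦ (v_1 ∧ ⋯ ∧ v_a) ⊗ w)`. -/
def tw (R V W : Type*) [CommRing R] [AddCommGroup V] [Module R V] [AddCommGroup W] [Module R W]
    (a : ℕ) : W →ₗ[R] V [⋀^Fin a]→ₗ[R] ((⋀[R]^a V) ⊗[R] W) :=
  (exteriorPower.alternatingMapLinearEquiv (R := R) (M := V) (n := a)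
    (N := (⋀[R]^a V) ⊗[R] W)).symm.toLinearMap ∘ₗ
    (TensorProduct.mk R (⋀[R]^a V) W).flip

lemma tw_apply (a : ℕ) (w : W) (v : Fin a → V) :
    tw R V W a w v = exteriorPower.ιMulti R a v ⊗ₜ[R] w := by
  simp [tw, exteriorPower.alternatingMapLinearEquiv_symm_apply]

/-- auxiliary -/
def kzAux (mu : V →ₗ[R] W →ₗ[R] W') (a : ℕ) :
    W →ₗ[R] (V →ₗ[R] (V [⋀^Fin a]→ₗ[R] ((⋀[R]^a V) ⊗[R] W'))) :=
  (LinearMap.llcomp R V W' (V [⋀^Fin a]→ₗ[R] ((⋀[R]^a V) ⊗[R] W')) (tw R V W' a)) ∘ₗ mu.flip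

lemma kzAux_apply (mu : V →ₗ[R] W →ₗ[R] W') (a : ℕ) (w : W) (x : V) (v : Fin a → V) :
    kzAux mu a w x v = exteriorPower.ιMulti R a v ⊗ₜ[R] mu x w := by
  simp [kzAux, tw_apply]

/-- The Koszul map attached to a bilinear map. -/
def kz (mu : V →ₗ[R] W →ₗ[R] W') (a : ℕ) :
    ((⋀[R]^(a + 1) V) ⊗[R] W) →ₗ[R] ((⋀[R]^a V) ⊗[R] W') :=
  TensorProduct.lift (LinearMap.flip
    ((exteriorPower.alternatingMapLinearEquiv (R := R) (M := V) (n := a + 1)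
    (N := (⋀[R]^a V) ⊗[R] W')).toLinearMap ∘ₗ
      (AlternatingMap.alternatizeUncurryFinLM (R := R) (M := V) (n := a)
        (N := (⋀[R]^a V) ⊗[R] W')) ∘ₗ kzAux mu a))

lemma kz_apply (mu : V →ₗ[R] W →ₗ[R] W') (a : ℕ) (v : Fin (a + 1) → V) (w : W) :
    kz mu a (exteriorPower.ιMulti R (a + 1) v ⊗ₜ[R] w) =
      ∑ j : Fin (a + 1), ((-1 : ℤ) ^ (j : ℕ)) •
        (exteriorPower.ιMulti R a (j.removeNth v) ⊗ₜ[R] mu (v j) w) := by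
  simp only [kz, TensorProduct.lift.tmul, LinearMap.flip_apply, LinearMap.comp_apply,
    LinearEquiv.coe_coe, exteriorPower.alternatingMapLinearEquiv_apply_ιMulti,
    AlternatingMap.alternatizeUncurryFinLM_apply, AlternatingMap.alternatizeUncurryFin_apply,
    kzAux_apply]

lemma wedge_tmul_ext {a : ℕ} {N : Type*} [AddCommGroup N] [Module R N]
    {F G : ((⋀[R]^a V) ⊗[R] W) →ₗ[R] N}
    (h : ∀ v w, F (exteriorPower.ιMulti R a v ⊗ₜ[R] w) = G (exteriorPower.ιMulti R a v ⊗ₜ[R] w)) :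
    F = G := by
  refine TensorProduct.ext' fun x w => ?_
  have : F ∘ₗ (TensorProduct.mk R (⋀[R]^a V) W).flip w =
      G ∘ₗ (TensorProduct.mk R (⋀[R]^a V) W).flip w := by
    refine exteriorPower.linearMap_ext ?_
    ext v
    exact h v w
  exact LinearMap.congr_fun this x

lemma kz_kz (mu : V →ₗ[R] W →ₗ[R] W') (mu' : V →ₗ[R] W' →ₗ[R] W'')
    (hs : ∀ x y w, mu' x (mu y w) = mu' y (mu x w)) (a : ℕ) (x) :
    kz mu' a (kz mu (a + 1) x) = 0 := by
  suffices h : kz mu' a ∘ₗ kz mu (a + 1) = 0 from LinearMap.congr_fun h x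
  refine wedge_tmul_ext (R := R) (V := V) (W := W) (a := a + 2)
    (N := (⋀[R]^a V) ⊗[R] W'') fun v w => ?_
  have := AlternatingMap.alternatizeUncurryFin_alternatizeUncurryFinLM_comp_of_symmetric
    (R := R) (M := V) (n := a) (N := (⋀[R]^a V) ⊗[R] W'')
    (f := kzAux mu' a ∘ₗ mu.flip w) (by
      intro x y
      ext u
      simp [kzAux_apply, hs y x])
  have := congrArg (fun g => g v) this
  simp only [AlternatingMap.alternatizeUncurryFin_apply, LinearMap.comp_apply,
    AlternatingMap.alternatizeUncurryFinLM_apply, kzAux_apply, LinearMap.flip_apply] at this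
  simpa [kz_apply, map_sum, map_zsmul] using this

lemma removeNth_succ_vecCons {V : Type*} {a : ℕ} (x : V) (v : Fin (a + 1) → V) (j : Fin (a + 1)) :
    j.succ.removeNth (Matrix.vecCons x v) = Matrix.vecCons x (j.removeNth v) := by
  funext i
  refine Fin.cases ?_ (fun i => ?_) i
  · simp [Fin.removeNth_apply]
  · simp [Fin.removeNth_apply]

lemma removeNth_zero_vecCons {V : Type*} {a : ℕ} (x : V) (v : Fin a → V) :
    (0 : Fin (a + 1)).removeNth (Matrix.vecCons x v) = v := by
  funext i
  simp [Fin.removeNth_apply]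

/-- Koszul map on a wedge with two distinguished factors. -/
lemma kz_cons_cons (mu : V →ₗ[R] W →ₗ[R] W') (a : ℕ) (x y : V) (v : Fin (a + 1) → V) (w : W) :
    kz mu (a + 1 + 1) (exteriorPower.ιMulti R (a + 1 + 1 + 1) (Matrix.vecCons x (Matrix.vecCons y v)) ⊗ₜ[R] w) =
      exteriorPower.ιMulti R (a + 1 + 1) (Matrix.vecCons y v) ⊗ₜ[R] mu x w
      - exteriorPower.ιMulti R (a + 1 + 1) (Matrix.vecCons x v) ⊗ₜ[R] mu y w
      + ∑ j : Fin (a + 1), ((-1 : ℤ) ^ (j : ℕ)) •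
        (exteriorPower.ιMulti R (a + 1 + 1) (Matrix.vecCons x (Matrix.vecCons y (j.removeNth v)))
          ⊗ₜ[R] mu (v j) w) := by
  rw [kz_apply, Fin.sum_univ_succ, Fin.sum_univ_succ, sub_eq_add_neg,
    add_assoc (_ ⊗ₜ[R] _)]
  simp only [removeNth_succ_vecCons, removeNth_zero_vecCons, Matrix.cons_val_zero,
    Matrix.cons_val_succ, Fin.val_succ, Fin.val_zero, pow_zero, one_smul, pow_succ, one_mul,
    mul_neg, mul_one, neg_neg, neg_smul]

end generic

lemma skipAt_eq {a : ℕ} (j : Fin (a + 1)) (i : Fin a) :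
    skipAt (a := a + 1) j i = j.succAbove i := by
  unfold skipAt Fin.succAbove
  ext
  split_ifs <;> (simp_all [Fin.lt_def]; try omega)

variable (K : Type*) [Field K]

/-- multiplication as a bilinear map -/
def mulB (n d b : ℕ) : S K n d →ₗ[K] S K n b →ₗ[K] S K n (b + d) :=
  LinearMap.mk₂ K (fun s w => mulSW K s w)
    (fun _ _ _ => Subtype.ext (by simp [mulSW, add_mul]))
    (fun _ _ _ => Subtype.ext (by simp [mulSW]))
    (fun _ _ _ => Subtype.ext (by simp [mulSW, mul_add]))
    (fun _ _ _ => Subtype.ext (by simp [mulSW]))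

lemma isKoszul_kz (n d a b : ℕ) : IsKoszulMap K n d (a + 1) b (kz (mulB K n d b) a) := by
  intro s w
  refine (kz_apply (mulB K n d b) a s w).trans ?_
  refine Finset.sum_congr rfl fun j _ => ?_
  have : (fun i => s (skipAt (a := a + 1) j i)) = j.removeNth s := by
    funext i; rw [skipAt_eq]; rfl
  rw [this]
  rcases Nat.even_or_odd (j : ℕ) with h | h
  · rw [h.neg_one_pow, h.neg_one_pow, one_smul, one_smul]; rfl
  · rw [h.neg_one_pow, h.neg_one_pow, neg_one_smul]; exact (neg_one_smul K _).symm


section natural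

variable {R V W W' W₁ W₁' : Type*} [CommRing R] [AddCommGroup V] [Module R V]
  [AddCommGroup W] [Module R W] [AddCommGroup W'] [Module R W']
  [AddCommGroup W₁] [Module R W₁] [AddCommGroup W₁'] [Module R W₁']

lemma kz_natural (mu : V →ₗ[R] W →ₗ[R] W') (mu₁ : V →ₗ[R] W₁ →ₗ[R] W₁')
    (f : W →ₗ[R] W₁) (g : W' →ₗ[R] W₁') (h : ∀ v w, g (mu v w) = mu₁ v (f w)) (a : ℕ) (x) :
    LinearMap.lTensor (⋀[R]^a V) g (kz mu a x) =
      kz mu₁ a (LinearMap.lTensor (⋀[R]^(a + 1) V) f x) := by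
  suffices H : LinearMap.lTensor (⋀[R]^a V) g ∘ₗ kz mu a =
    kz mu₁ a ∘ₗ LinearMap.lTensor (⋀[R]^(a + 1) V) f from LinearMap.congr_fun H x
  refine wedge_tmul_ext (R := R) (V := V) (W := W) (a := a + 1)
    (N := (⋀[R]^a V) ⊗[R] W₁') fun v w => ?_
  simp only [LinearMap.comp_apply, kz_apply, LinearMap.lTensor_tmul, map_sum, map_zsmul, h]

/-- determinant functional -/
def Phi {p : ℕ} (u : Fin p → (V →ₗ[R] R)) (ψ : W →ₗ[R] R) : ((⋀[R]^p V) ⊗[R] W) →ₗ[R] R :=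
  LinearMap.mul' R R ∘ₗ TensorProduct.map
    (exteriorPower.alternatingMapLinearEquiv (R := R) (M := V) (n := p) (N := R)
      ((Matrix.detRowAlternating (R := R) (n := Fin p)).compLinearMap (LinearMap.pi u))) ψ

lemma Phi_apply {p : ℕ} (u : Fin p → (V →ₗ[R] R)) (ψ : W →ₗ[R] R) (v : Fin p → V) (w : W) :
    Phi u ψ (exteriorPower.ιMulti R p v ⊗ₜ[R] w) =
      Matrix.det (Matrix.of fun i j => u j (v i)) * ψ w := by
  simp only [Phi, LinearMap.comp_apply, TensorProduct.map_tmul, LinearMap.mul'_apply,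
    exteriorPower.alternatingMapLinearEquiv_apply_ιMulti]
  rfl

lemma Phi_eq_zero {p : ℕ} (u : Fin p → (V →ₗ[R] R)) (ψ : W →ₗ[R] R) (v : Fin p → V) (w : W)
    (i : Fin p) (h : ∀ j, u j (v i) = 0) :
    Phi u ψ (exteriorPower.ιMulti R p v ⊗ₜ[R] w) = 0 := by
  rw [Phi_apply, Matrix.det_eq_zero_of_row_eq_zero i (by simpa using h), zero_mul]

lemma Phi_kz [IsDomain R] {p : ℕ} (u : Fin p → (V →ₗ[R] R)) (ψ : W' →ₗ[R] R)
    (mu : V →ₗ[R] W →ₗ[R] W')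
    (h : ∀ w, ∃ c : Fin p → R, ∀ v, ψ (mu v w) = ∑ k, c k * u k v) (x) :
    Phi u ψ (kz mu p x) = 0 := by
  suffices H : Phi u ψ ∘ₗ kz mu p = 0 from LinearMap.congr_fun H x
  refine wedge_tmul_ext fun v w => ?_
  obtain ⟨c, hc⟩ := h w
  let A : Matrix (Fin (p + 1)) (Fin (p + 1)) R :=
    Matrix.of fun i j => Matrix.vecCons (ψ (mu (v i) w)) (fun k => u k (v i)) j
  have hA : A.det = 0 := by
    rw [← Matrix.exists_mulVec_eq_zero_iff]
    refine ⟨Matrix.vecCons (-1) c, fun h0 => ?_, ?_⟩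
    · simpa using congrFun h0 0
    · funext i
      simp only [Matrix.mulVec, dotProduct, A, Matrix.of_apply, Fin.sum_univ_succ, Matrix.cons_val_zero,
        Matrix.cons_val_succ, hc, Pi.zero_apply]
      simp [mul_comm]
  rw [Matrix.det_succ_column_zero] at hA
  simp only [LinearMap.comp_apply, kz_apply, map_sum, map_zsmul, Phi_apply, LinearMap.zero_apply]
  rw [← hA]
  refine Finset.sum_congr rfl fun j _ => ?_
  have : A.submatrix j.succAbove Fin.succ = Matrix.of fun i k => u k (j.removeNth v i) := by
    ext i k
    simp [A, Fin.removeNth_apply]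
  rw [this]
  simp only [A, Matrix.of_apply, Matrix.cons_val_zero, zsmul_eq_mul]
  push_cast
  ring

lemma sum_lin {G ι : Type*} [AddCommGroup G] (s : Finset ι) (A B C : ι → G) :
    ∑ j ∈ s, (A j - B j + C j) = ∑ j ∈ s, A j - ∑ j ∈ s, B j + ∑ j ∈ s, C j := by
  rw [Finset.sum_add_distrib, Finset.sum_sub_distrib]

lemma cycle_gen {P : Type*} [AddCommGroup P] [Module R P]
    (mu : V →ₗ[R] W →ₗ[R] W') (muP : V →ₗ[R] P →ₗ[R] P)
    (f : W →ₗ[R] P) (g : W' →ₗ[R] P) (hg : Function.Injective g)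
    (hfg : ∀ v w, g (mu v w) = muP v (f w))
    (X : P →ₗ[R] P) (hX : Function.Injective X) (hXm : ∀ v w, X (muP v w) = muP v (X w))
    (hcomm : ∀ x y w, muP x (muP y w) = muP y (muP x w))
    (a : ℕ) [Module.Flat R (⋀[R]^(a + 1) V)] (v : Fin (a + 1) → V)
    (x0 x1 x2 : V) (y0 y1 y2 : P)
    (h01 : muP x0 y1 = muP x1 y0) (h02 : muP x0 y2 = muP x2 y0) (h12 : muP x1 y2 = muP x2 y1)
    (p0 p1 p2 : Fin (a + 1) → W)
    (hp0 : ∀ j, X (f (p0 j)) = muP (v j) y0)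
    (hp1 : ∀ j, X (f (p1 j)) = muP (v j) y1)
    (hp2 : ∀ j, X (f (p2 j)) = muP (v j) y2) :
    kz mu (a + 1) (∑ j : Fin (a + 1), ((-1 : ℤ) ^ (j : ℕ)) •
      (exteriorPower.ιMulti R (a + 1 + 1) (Matrix.vecCons x1 (Matrix.vecCons x2 (j.removeNth v)))
          ⊗ₜ[R] p0 j
        - exteriorPower.ιMulti R (a + 1 + 1) (Matrix.vecCons x0 (Matrix.vecCons x2 (j.removeNth v)))
          ⊗ₜ[R] p1 j
        + exteriorPower.ιMulti R (a + 1 + 1) (Matrix.vecCons x0 (Matrix.vecCons x1 (j.removeNth v)))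
          ⊗ₜ[R] p2 j)) = 0 := by
  apply Module.Flat.lTensor_preserves_injective_linearMap (M := ⋀[R]^(a + 1) V) g hg
  rw [map_zero, kz_natural _ muP f _ hfg]
  apply Module.Flat.lTensor_preserves_injective_linearMap (M := ⋀[R]^(a + 1) V) X hX
  rw [map_zero, kz_natural _ muP X _ hXm]
  refine Eq.trans ?_ (kz_kz muP muP hcomm (a + 1)
    (exteriorPower.ιMulti R (a + 1 + 1 + 1) (Matrix.vecCons x1 (Matrix.vecCons x2 v)) ⊗ₜ[R] y0
     - exteriorPower.ιMulti R (a + 1 + 1 + 1) (Matrix.vecCons x0 (Matrix.vecCons x2 v)) ⊗ₜ[R] y1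
     + exteriorPower.ιMulti R (a + 1 + 1 + 1) (Matrix.vecCons x0 (Matrix.vecCons x1 v)) ⊗ₜ[R] y2))
  refine congrArg (kz muP (a + 1)) ?_
  rw [map_add, map_sub, kz_cons_cons, kz_cons_cons, kz_cons_cons]
  have hL : ∀ (j : Fin (a + 1)) (t : (⋀[R]^(a + 1 + 1) V) ⊗[R] W),
      LinearMap.lTensor (⋀[R]^(a + 1 + 1) V) X (LinearMap.lTensor (⋀[R]^(a + 1 + 1) V) f
        (((-1 : ℤ) ^ (j : ℕ)) • t)) = ((-1 : ℤ) ^ (j : ℕ)) •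
      LinearMap.lTensor (⋀[R]^(a + 1 + 1) V) X (LinearMap.lTensor (⋀[R]^(a + 1 + 1) V) f t) := by
    intro j t
    rcases Nat.even_or_odd (j : ℕ) with h | h
    · rw [h.neg_one_pow, one_smul, one_smul]
    · rw [h.neg_one_pow, neg_one_smul, neg_one_smul, map_neg, map_neg]
  simp only [map_sum, hL]
  simp only [h01, h02, h12, map_add, map_sub, LinearMap.lTensor_tmul,
    hp0, hp1, hp2, smul_add, smul_sub]
  refine (sum_lin _ _ _ _).trans ?_
  abel

/-- the candidate cycle -/
def zet (a : ℕ) (v : Fin (a + 1) → V) (x0 x1 x2 : V) (p0 p1 p2 : Fin (a + 1) → W) :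
    (⋀[R]^(a + 1 + 1) V) ⊗[R] W :=
  ∑ j : Fin (a + 1), ((-1 : ℤ) ^ (j : ℕ)) •
      (exteriorPower.ιMulti R (a + 1 + 1) (Matrix.vecCons x1 (Matrix.vecCons x2 (j.removeNth v)))
          ⊗ₜ[R] p0 j
        - exteriorPower.ιMulti R (a + 1 + 1) (Matrix.vecCons x0 (Matrix.vecCons x2 (j.removeNth v)))
          ⊗ₜ[R] p1 j
        + exteriorPower.ιMulti R (a + 1 + 1) (Matrix.vecCons x0 (Matrix.vecCons x1 (j.removeNth v)))
          ⊗ₜ[R] p2 j)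

lemma Phi_zet {a : ℕ} (u : Fin (a + 1 + 1) → (V →ₗ[R] R)) (ψ : W →ₗ[R] R)
    (v : Fin (a + 1) → V) (x0 x1 x2 : V) (p0 p1 p2 : Fin (a + 1) → W)
    (hx0 : ∀ k, u k x0 = 0) (hv0 : ∀ k, u k (v 0) = 0) :
    Phi u ψ (zet a v x0 x1 x2 p0 p1 p2) = Matrix.det (Matrix.of fun i j =>
      u j ((Matrix.vecCons x1 (Matrix.vecCons x2 ((0 : Fin (a + 1)).removeNth v)) :
        Fin (a + 1 + 1) → V) i)) * ψ (p0 0) := by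
  rw [zet, map_sum, Finset.sum_eq_single 0]
  · rw [Fin.val_zero, pow_zero, one_smul, map_add, map_sub,
      Phi_eq_zero u ψ (Matrix.vecCons x0 (Matrix.vecCons x2 _)) _ 0 hx0,
      Phi_eq_zero u ψ (Matrix.vecCons x0 (Matrix.vecCons x1 _)) _ 0 hx0, sub_zero,
      add_zero, Phi_apply]
  · intro j _ hj
    obtain ⟨i, hi⟩ := Fin.exists_succAbove_eq hj.symm
    have hr : (j.removeNth v) i = v 0 := by
      rw [Fin.removeNth_apply, hi]
    have H : ∀ x y w, Phi u ψ
        (exteriorPower.ιMulti R (a + 1 + 1)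
          (Matrix.vecCons x (Matrix.vecCons y (j.removeNth v))) ⊗ₜ[R] w) = 0 := by
      intro x y w
      refine Phi_eq_zero _ _ _ _ (Fin.succ (Fin.succ i)) fun k => ?_
      simp only [Matrix.cons_val_succ, hr, hv0]
    rcases Nat.even_or_odd (j : ℕ) with h | h
    · rw [h.neg_one_pow, one_smul, map_add, map_sub, H, H, H]; simp
    · rw [h.neg_one_pow, neg_one_smul, map_neg, map_add, map_sub, H, H, H]; simp
  · intro h; exact absurd (Finset.mem_univ _) h

end natural

variable {K}

/-- multiplication on the full polynomial ring -/
def mulP (K : Type*) [Field K] (n d : ℕ) : S K n d →ₗ[K]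
    MvPolynomial (Fin (n + 1)) K →ₗ[K] MvPolynomial (Fin (n + 1)) K :=
  LinearMap.mul K (MvPolynomial (Fin (n + 1)) K) ∘ₗ (S K n d).subtype

lemma cycle (n d a b : ℕ) (v : Fin (a + 1) → S K n d)
    (v' : Fin (a + 1) → MvPolynomial (Fin (n + 1)) K)
    (X : MvPolynomial (Fin (n + 1)) K) (hX : X ≠ 0)
    (hv : ∀ j, (v j : MvPolynomial (Fin (n + 1)) K) = X * v' j)
    (x0 x1 x2 : S K n d) (y0 y1 y2 : MvPolynomial (Fin (n + 1)) K)
    (h01 : x0 * y1 = x1 * y0) (h02 : x0 * y2 = x2 * y0) (h12 : x1 * y2 = x2 * y1)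
    (p0 p1 p2 : Fin (a + 1) → S K n b)
    (hp0 : ∀ j, (p0 j : MvPolynomial (Fin (n + 1)) K) = v' j * y0)
    (hp1 : ∀ j, (p1 j : MvPolynomial (Fin (n + 1)) K) = v' j * y1)
    (hp2 : ∀ j, (p2 j : MvPolynomial (Fin (n + 1)) K) = v' j * y2) :
    kz (mulB K n d b) (a + 1) (zet a v x0 x1 x2 p0 p1 p2) = 0 := by
  refine cycle_gen (mulB K n d b) (mulP K n d) (S K n b).subtype (S K n (b + d)).subtype
    Subtype.val_injective (fun _ _ => rfl) (LinearMap.mulLeft K X)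
    (fun p q h => mul_left_cancel₀ hX h) (fun v w => ?_) (fun x y w => ?_) a v x0 x1 x2 y0 y1 y2
    h01 h02 h12 p0 p1 p2 (fun j => ?_) (fun j => ?_) (fun j => ?_)
  · exact mul_left_comm _ _ _
  · exact mul_left_comm _ _ _
  · change X * (p0 j : MvPolynomial (Fin (n + 1)) K) = v j * y0
    rw [hp0, hv, mul_assoc]
  · change X * (p1 j : MvPolynomial (Fin (n + 1)) K) = v j * y1
    rw [hp1, hv, mul_assoc]
  · change X * (p2 j : MvPolynomial (Fin (n + 1)) K) = v j * y2
    rw [hp2, hv, mul_assoc]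


section concrete

/-- exponent vectors -/
def E (a b c : ℕ) : Fin (2 + 1) →₀ ℕ := Finsupp.equivFunOnFinite.symm ![a, b, c]

@[simp] lemma E_zero (a b c : ℕ) : E a b c 0 = a := rfl
@[simp] lemma E_one (a b c : ℕ) : E a b c 1 = b := rfl
@[simp] lemma E_two (a b c : ℕ) : E a b c 2 = c := rfl

lemma ext3 {s t : Fin (2 + 1) →₀ ℕ} (h0 : s 0 = t 0) (h1 : s 1 = t 1) (h2 : s 2 = t 2) : s = t := by
  ext i
  fin_cases i
  · exact h0
  · exact h1
  · exact h2

lemma degree3 (t : Fin (2 + 1) →₀ ℕ) : t.degree = t 0 + t 1 + t 2 := by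
  rw [Finsupp.degree_eq_sum, Fin.sum_univ_three]

/-- a monomial as an element of `S` -/
def mt (K : Type*) [Field K] (d : ℕ) (t : Fin (2 + 1) →₀ ℕ) (h : t 0 + t 1 + t 2 = d) : S K 2 d :=
  ⟨MvPolynomial.monomial t 1, by
    rw [MvPolynomial.mem_homogeneousSubmodule]
    exact MvPolynomial.isHomogeneous_monomial _ (by rw [degree3, h])⟩

/-- a coefficient functional -/
def cf (K : Type*) [Field K] (d : ℕ) (t : Fin (2 + 1) →₀ ℕ) : S K 2 d →ₗ[K] K :=
  MvPolynomial.lcoeff K t ∘ₗ (S K 2 d).subtype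

lemma cf_apply (d : ℕ) (t) (p : S K 2 d) :
    cf K d t p = MvPolynomial.coeff t (p : MvPolynomial (Fin (2 + 1)) K) := rfl

lemma cf_mt (d : ℕ) (s t) (h) : cf K d s (mt K d t h) = if t = s then 1 else 0 := by
  rw [cf_apply]
  exact MvPolynomial.coeff_monomial _ _ _

lemma cf_zero (d : ℕ) (t : Fin (2 + 1) →₀ ℕ) (h : t 0 + t 1 + t 2 ≠ d) : cf K d t = 0 := by
  ext p
  rw [cf_apply]
  by_contra h'
  refine h ?_
  have := (MvPolynomial.mem_homogeneousSubmodule _ _).1 p.2 h'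
  rw [← this, ← degree3, Finsupp.degree_eq_weight_one]
  rfl

variable (e : ℕ)

/-- exponents -/
def Aex (k : Fin (3 * e + 5)) : Fin (2 + 1) →₀ ℕ :=
  E ((k : ℕ) % (e + 2)) (e + 2 - (k : ℕ) % (e + 2) - (k : ℕ) / (e + 2)) ((k : ℕ) / (e + 2))

lemma Aex_spec (k : Fin (3 * e + 5)) :
    (Aex e k) 0 ≤ e + 1 ∧ (Aex e k) 2 ≤ 2 ∧ (Aex e k) 0 + (Aex e k) 1 + (Aex e k) 2 = e + 2 := by
  simp only [Aex, E_zero, E_one, E_two]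
  have hk := k.2
  have h1 := Nat.div_add_mod (k : ℕ) (e + 2)
  have h2 := Nat.mod_lt (k : ℕ) (show 0 < e + 2 by omega)
  generalize (k : ℕ) % (e + 2) = r at *
  generalize (k : ℕ) / (e + 2) = c at *
  have h3 : c ≤ 2 := by
    by_contra h
    have : (e + 2) * 3 ≤ (e + 2) * c := Nat.mul_le_mul_left _ (by omega)
    omega
  refine ⟨by omega, h3, ?_⟩
  interval_cases c <;> omega

lemma Aex_inj : Function.Injective (Aex e) := by
  intro k l h
  have h0 := congrArg (fun t => t 0) h
  have h2 := congrArg (fun t => t 2) h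
  simp only [Aex, E_zero, E_two] at h0 h2
  ext
  rw [← Nat.div_add_mod (k : ℕ) (e + 2), ← Nat.div_add_mod (l : ℕ) (e + 2), h0, h2]

lemma Aex_surj (t : Fin (2 + 1) →₀ ℕ) (h0 : t 0 ≤ e + 1) (h2 : t 2 ≤ 2)
    (h : t 0 + t 1 + t 2 = e + 2) : ∃ k, Aex e k = t := by
  have hb : (e + 2) * t 2 + t 0 < 3 * e + 5 := by
    generalize t 2 = c at *
    interval_cases c <;> omega
  refine ⟨⟨(e + 2) * t 2 + t 0, hb⟩, ?_⟩
  have hm : ((e + 2) * t 2 + t 0) % (e + 2) = t 0 := by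
    rw [Nat.mul_add_mod, Nat.mod_eq_of_lt (by omega)]
  have hd : ((e + 2) * t 2 + t 0) / (e + 2) = t 2 := by
    rw [Nat.mul_add_div (by omega), Nat.div_eq_of_lt (by omega), add_zero]
  apply ext3 <;> simp only [Aex, E_zero, E_one, E_two, hm, hd]
  omega

/-- all exponents -/
def U : Fin (3 * e + 5 + 1 + 1) → (Fin (2 + 1) →₀ ℕ) :=
  Matrix.vecCons (E 0 (e + 2) 1) (Matrix.vecCons (E 0 (e + 1) 2) fun k => E 1 0 0 + Aex e k)

lemma U_zero : U e 0 = E 0 (e + 2) 1 := rfl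
lemma U_one : U e (Fin.succ 0) = E 0 (e + 1) 2 := rfl
lemma U_succ (k) : U e (Fin.succ (Fin.succ k)) = E 1 0 0 + Aex e k := rfl

lemma U_spec (k) : (U e k) 0 ≤ e + 2 ∧ (U e k) 1 ≤ e + 2 ∧ (U e k) 0 + (U e k) 1 + (U e k) 2 = e + 3 := by
  refine Fin.cases ?_ (fun k => Fin.cases ?_ (fun k => ?_) k) k
  · rw [U_zero]; simp
  · rw [U_one]; simp
  · have := Aex_spec e k
    rw [U_succ]; simp; omega

lemma U_inj : Function.Injective (U e) := by
  intro k l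
  refine Fin.cases ?_ (fun k => Fin.cases ?_ (fun k => ?_) k) k <;>
  refine Fin.cases ?_ (fun l => Fin.cases ?_ (fun l => ?_) l) l <;>
  intro h <;>
  have h0 := congrArg (fun t => t 0) h <;>
  have h1 := congrArg (fun t => t 1) h <;>
  simp only [U_zero, U_one, U_succ, E_zero, E_one, Finsupp.add_apply] at h0 h1 <;>
  first | rfl | (exfalso; omega) | skip
  rw [U_succ, U_succ] at h
  rw [Aex_inj e (add_left_cancel h)]

lemma U_surj (t : Fin (2 + 1) →₀ ℕ) (h0 : t 0 ≤ e + 2) (h1 : t 1 ≤ e + 2) (h2 : t 2 ≤ 2)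
    (h : t 0 + t 1 + t 2 = e + 3) : ∃ k, U e k = t := by
  rcases Nat.eq_zero_or_pos (t 0) with hz | hz
  · have : t 2 = 1 ∨ t 2 = 2 := by omega
    rcases this with h' | h'
    · exact ⟨0, by rw [U_zero]; apply ext3 <;> simp <;> omega⟩
    · exact ⟨Fin.succ 0, by rw [U_one]; apply ext3 <;> simp <;> omega⟩
  · obtain ⟨k, hk⟩ := Aex_surj e (E (t 0 - 1) (t 1) (t 2)) (by simp; omega) (by simp; omega)
      (by simp; omega)
    refine ⟨k.succ.succ, ?_⟩
    rw [U_succ, hk]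
    apply ext3 <;> simp
    omega

/-- target exponent -/
def mm : Fin (2 + 1) →₀ ℕ := E (e + 2) (e + 2) 2

lemma span_cond (b : ℕ) (w : S K 2 b) :
    ∃ c : Fin (3 * e + 5 + 1 + 1) → K, ∀ v,
      cf K (b + (e + 3)) (mm e) (mulB K 2 (e + 3) b v w) = ∑ k, c k * cf K (e + 3) (U e k) v := by
  have key : (cf K (b + (e + 3)) (mm e)) ∘ₗ (mulB K 2 (e + 3) b).flip w ∈
      Submodule.span K (Set.range fun k => cf K (e + 3) (U e k)) := by
    have : (cf K (b + (e + 3)) (mm e)) ∘ₗ (mulB K 2 (e + 3) b).flip w =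
        ∑ x ∈ Finset.HasAntidiagonal.antidiagonal (mm e),
          MvPolynomial.coeff x.2 (w : MvPolynomial (Fin (2 + 1)) K) • cf K (e + 3) x.1 := by
      ext v
      rw [LinearMap.sum_apply]
      refine (MvPolynomial.coeff_mul _ _ _).trans (Finset.sum_congr rfl fun x _ => ?_)
      rw [LinearMap.smul_apply, smul_eq_mul, mul_comm, cf_apply]
    rw [this]
    refine Submodule.sum_mem _ fun x hx => Submodule.smul_mem _ _ ?_
    by_cases hd : x.1 0 + x.1 1 + x.1 2 = e + 3
    · rw [Finset.HasAntidiagonal.mem_antidiagonal] at hx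
      have h0 := congrArg (fun t => t 0) hx
      have h1 := congrArg (fun t => t 1) hx
      have h2 := congrArg (fun t => t 2) hx
      simp [mm] at h0 h1 h2
      obtain ⟨k, hk⟩ := U_surj e x.1 (by omega) (by omega) (by omega) hd
      exact Submodule.subset_span ⟨k, by simp only [hk]⟩
    · rw [cf_zero _ _ hd]
      exact Submodule.zero_mem _
  obtain ⟨c, hc⟩ := (Submodule.mem_span_range_iff_exists_fun K).1 key
  refine ⟨c, fun v => ?_⟩
  have := LinearMap.congr_fun hc v
  rw [LinearMap.sum_apply] at this
  exact this.symm

/-- exponents of the reduced vectors -/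
def Vex : Fin (3 * e + 5 + 1) → (Fin (2 + 1) →₀ ℕ) := Matrix.vecCons (E (e + 2) 0 0) (Aex e)

lemma Vex_spec (j) : (Vex e j) 0 + (Vex e j) 1 + (Vex e j) 2 = e + 2 := by
  refine Fin.cases ?_ (fun k => ?_) j
  · simp [Vex]
  · simpa [Vex] using (Aex_spec e k).2.2

variable (K)

/-- the vectors `v` -/
def vv (j : Fin (3 * e + 5 + 1)) : S K 2 (e + 3) :=
  mt K (e + 3) (E 1 0 0 + Vex e j) (by have := Vex_spec e j; simp; omega)

/-- the coefficients -/
def pp (y : Fin (2 + 1) →₀ ℕ) (hy : y 0 + y 1 + y 2 = e + 4) (j : Fin (3 * e + 5 + 1)) :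
    S K 2 (2 * (e + 3)) :=
  mt K (2 * (e + 3)) (Vex e j + y) (by have := Vex_spec e j; simp; omega)

/-- the first row vectors -/
def xx (b c : ℕ) (h : b + c = e + 3) : S K 2 (e + 3) := mt K (e + 3) (E 0 b c) (by simpa using h)

/-- the nontrivial cycle -/
def zeta : (⋀[K]^(3 * e + 5 + 1 + 1) (S K 2 (e + 3))) ⊗[K] (S K 2 (2 * (e + 3))) :=
  zet (3 * e + 5) (vv K e) (xx K e (e + 3) 0 rfl) (xx K e (e + 2) 1 rfl) (xx K e (e + 1) 2 rfl)
    (pp K e (E 0 (e + 2) 2) (by simp)) (pp K e (E 0 (e + 1) 3) (by simp))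
    (pp K e (E 0 e 4) (by simp))

lemma mon_mul (a b c d : Fin (2 + 1) →₀ ℕ) (h : a + b = c + d) :
    (MvPolynomial.monomial a 1 * MvPolynomial.monomial b 1 : MvPolynomial (Fin (2 + 1)) K) =
    MvPolynomial.monomial c 1 * MvPolynomial.monomial d 1 := by
  rw [MvPolynomial.monomial_mul, MvPolynomial.monomial_mul, h]

lemma mon_add (a b : Fin (2 + 1) →₀ ℕ) :
    (MvPolynomial.monomial (a + b) 1 : MvPolynomial (Fin (2 + 1)) K) =
    MvPolynomial.monomial a 1 * MvPolynomial.monomial b 1 := by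
  rw [MvPolynomial.monomial_mul, one_mul]

lemma vv_coe (j) : (vv K e j : MvPolynomial (Fin (2 + 1)) K) =
    MvPolynomial.monomial (E 1 0 0) 1 * MvPolynomial.monomial (Vex e j) 1 := mon_add K _ _

lemma pp_coe (y hy j) : (pp K e y hy j : MvPolynomial (Fin (2 + 1)) K) =
    MvPolynomial.monomial (Vex e j) 1 * MvPolynomial.monomial y 1 := mon_add K _ _

lemma xx_mul (b c h b' c' h' y y') (h1 : b + y 1 = b' + y' 1) (h2 : c + y 2 = c' + y' 2)
    (h0 : y 0 = y' 0) :
    (xx K e b c h : MvPolynomial (Fin (2 + 1)) K) * MvPolynomial.monomial y 1 =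
    (xx K e b' c' h' : MvPolynomial (Fin (2 + 1)) K) * MvPolynomial.monomial y' 1 := by
  refine mon_mul K _ _ _ _ ?_
  apply ext3 <;> simp [h0, h1, h2]

lemma zeta_cycle : kz (mulB K 2 (e + 3) (2 * (e + 3))) (3 * e + 5 + 1) (zeta K e) = 0 := by
  rw [zeta]
  refine cycle 2 (e + 3) (3 * e + 5) (2 * (e + 3)) (vv K e)
    (fun j => MvPolynomial.monomial (Vex e j) 1) (MvPolynomial.monomial (E 1 0 0) 1)
    (by simp [MvPolynomial.monomial_eq_zero]) (vv_coe K e)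
    (xx K e (e + 3) 0 rfl) (xx K e (e + 2) 1 rfl) (xx K e (e + 1) 2 rfl)
    (MvPolynomial.monomial (E 0 (e + 2) 2) 1) (MvPolynomial.monomial (E 0 (e + 1) 3) 1)
    (MvPolynomial.monomial (E 0 e 4) 1)
    (xx_mul K e _ _ _ _ _ _ _ _ ?_ ?_ ?_) (xx_mul K e _ _ _ _ _ _ _ _ ?_ ?_ ?_)
    (xx_mul K e _ _ _ _ _ _ _ _ ?_ ?_ ?_)
    _ _ _ (pp_coe K e _ _) (pp_coe K e _ _) (pp_coe K e _ _) <;>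
  simp only [E_zero, E_one, E_two] <;> omega

lemma rows (i) : (Matrix.vecCons (xx K e (e + 2) 1 rfl)
          (Matrix.vecCons (xx K e (e + 1) 2 rfl)
            ((0 : Fin (3 * e + 5 + 1)).removeNth (vv K e))) : Fin (3 * e + 5 + 1 + 1) → _) i =
        mt K (e + 3) (U e i) (U_spec e i).2.2 := by
  refine Fin.cases ?_ (fun k => Fin.cases ?_ (fun k => ?_) k) i
  · rfl
  · rfl
  · rfl

lemma zeta_val : Phi (fun k => cf K (e + 3) (U e k)) (cf K (2 * (e + 3)) (mm e)) (zeta K e) = 1 := by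
  have hx0 : ∀ k, cf K (e + 3) (U e k) (xx K e (e + 3) 0 rfl) = 0 := by
    intro k
    rw [xx, cf_mt, if_neg]
    intro h
    have h1 := (U_spec e k).2.1
    rw [← h] at h1
    simp at h1
  have hv0 : ∀ k, cf K (e + 3) (U e k) (vv K e 0) = 0 := by
    intro k
    rw [vv, cf_mt, if_neg]
    intro h
    have h1 := (U_spec e k).1
    rw [← h] at h1
    simp only [Vex, Finsupp.add_apply, E_zero, Matrix.cons_val_zero] at h1
    omega
  have hp : cf K (2 * (e + 3)) (mm e) (pp K e (E 0 (e + 2) 2) (by simp) 0) = 1 := by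
    rw [pp, cf_mt, if_pos]
    apply ext3 <;> simp [Vex, mm]
  rw [zeta, Phi_zet (fun k => cf K (e + 3) (U e k)) _ _ _ _ _ _ _ _ hx0 hv0, hp, mul_one]
  have : (Matrix.of fun i j => cf K (e + 3) (U e j) ((Matrix.vecCons (xx K e (e + 2) 1 rfl)
          (Matrix.vecCons (xx K e (e + 1) 2 rfl)
            ((0 : Fin (3 * e + 5 + 1)).removeNth (vv K e))) : Fin (3 * e + 5 + 1 + 1) → _) i)) = 1 := by
    ext i j
    rw [Matrix.of_apply, rows, cf_mt, Matrix.one_apply]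
    simp only [(U_inj e).eq_iff]
  rw [this, Matrix.det_one]

lemma main : ¬ VKExact K 2 (e + 3) (3 * e + 5 + 1 + 1) 2 := by
  intro hE
  have h : (2 - 1) * (e + 3) + (e + 3) = 2 * (e + 3) := by omega
  have := hE h (kz (mulB K 2 (e + 3) (2 * (e + 3))) (3 * e + 5 + 1))
    (kz (mulB K 2 (e + 3) ((2 - 1) * (e + 3))) (3 * e + 5 + 1 + 1))
    (isKoszul_kz K _ _ _ _) (isKoszul_kz K _ _ _ _)
  have hz : zeta K e ∈ LinearMap.ker (kz (mulB K 2 (e + 3) (2 * (e + 3))) (3 * e + 5 + 1)) :=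
    zeta_cycle K e
  have hz' := this ▸ hz
  obtain ⟨x, hx⟩ := hz'
  have hPhi : Phi (fun k => cf K (e + 3) (U e k)) (cf K (2 * (e + 3)) (mm e)) ∘ₗ
      (TensorProduct.congr (LinearEquiv.refl K (⋀[K]^(3 * e + 5 + 1 + 1) (S K 2 (e + 3))))
            (scast K h)).toLinearMap =
      Phi (fun k => cf K (e + 3) (U e k)) (cf K ((2 - 1) * (e + 3) + (e + 3)) (mm e)) := by
    refine wedge_tmul_ext fun v w => ?_
    rw [LinearMap.comp_apply, Phi_apply]
    exact Phi_apply _ _ _ _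
  have h0 := Phi_kz (fun k => cf K (e + 3) (U e k)) (cf K ((2 - 1) * (e + 3) + (e + 3)) (mm e))
    (mulB K 2 (e + 3) ((2 - 1) * (e + 3))) (span_cond e _) x
  rw [← hPhi] at h0
  have h1 := zeta_val K e
  rw [← hx] at h1
  exact zero_ne_one (h0.symm.trans h1)

end concrete


end
end VK

/-- for `n = 2`, `d ≥ 3`, there is `q ≥ 2` such that the Veronese–Koszul complex
at `(3d−2, q)` is not exact. -/
theorem stmt7 (K : Type*) [Field K] [CharZero K] (d : ℕ) (hd : 3 ≤ d) :
    ∃ q, 2 ≤ q ∧ ¬ VKExact K 2 d (3 * d - 2) q := by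
  obtain ⟨e, rfl⟩ := Nat.exists_eq_add_of_le' hd
  refine ⟨2, le_refl 2, ?_⟩
  have h : 3 * (e + 3) - 2 = 3 * e + 5 + 1 + 1 := by omega
  rw [h]
  exact VK.main K e
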